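/- arXiv:2407.10196 — 7 statements merged into one kernel-verified Lean document; each statement's English description precedes it below -/
import Mathlib

section
/- Let Ω be a clustering of a finite set X of N samples and let C be a clustering of X (the ground truth). Suppose two distinct clusters w_1, w_2 ∈ Ω have a common dominant class c_1 ∈ C, with purities t_1 = |w_1 ∩ c_1|/|w_1| and t_2 = |w_2 ∩ c_1|/|w_2| satisfying t_1 ≥ 0.7 and t_2 ≥ 0.7. Let Ω* be obtained from Ω by merging w_1 and w_2, set n_1 = n(Ω,C) and n_2 = n(Ω*,C), and assume H(Ω)+H(C) > 0 and H(Ω*)+H(C) > 0. If n_1 ≥ 2·(1.0586 − min{t_1, t_2}), then n_2 ≥ n_1. -/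
open Finset

/-- `Ω` is a clustering (partition into nonempty clusters) of the finite set `X`. -/
def IsClustering {α : Type*} [DecidableEq α] (X : Finset α) (Ω : Finset (Finset α)) : Prop :=
  (∀ w ∈ Ω, w.Nonempty) ∧
  (∀ w ∈ Ω, ∀ w' ∈ Ω, w ≠ w' → Disjoint w w') ∧
  Ω.biUnion id = X

/-- Entropy of a clustering of `N` samples:  `H(Ω) = -∑ (|w|/N) log (|w|/N)`. -/
noncomputable def clEntropy {α : Type*} (N : ℕ) (Ω : Finset (Finset α)) : ℝ :=
  -∑ w ∈ Ω, ((w.card : ℝ) / N) * Real.log ((w.card : ℝ) / N)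

/-- Mutual information between two clusterings of `N` samples (with `0 · log 0 = 0`,
which holds automatically since `Real.log 0 = 0`). -/
noncomputable def clMI {α : Type*} [DecidableEq α] (N : ℕ) (Ω C : Finset (Finset α)) : ℝ :=
  ∑ w ∈ Ω, ∑ c ∈ C, (((w ∩ c).card : ℝ) / N) *
    Real.log (((N : ℝ) * ((w ∩ c).card : ℝ)) / ((w.card : ℝ) * (c.card : ℝ)))

/-- Normalized mutual information `n(Ω,C) = 2 I(Ω;C) / (H(Ω) + H(C))`. -/
noncomputable def clNMI {α : Type*} [DecidableEq α] (N : ℕ) (Ω C : Finset (Finset α)) : ℝ :=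
  2 * clMI N Ω C / (clEntropy N Ω + clEntropy N C)

/-- The clustering obtained from `Ω` by replacing `w₁` and `w₂` with `w₁ ∪ w₂`. -/
def mergeClusters {α : Type*} [DecidableEq α] (Ω : Finset (Finset α)) (w₁ w₂ : Finset α) :
    Finset (Finset α) :=
  insert (w₁ ∪ w₂) ((Ω.erase w₁).erase w₂)


noncomputable def mergeF (x y : ℝ) : ℝ :=
  (x + y) * Real.log (x + y) - x * Real.log x - y * Real.log y

theorem mergeF_aux {x y : ℝ} (hx : 0 ≤ x) (hy : 0 ≤ y) :
    x * Real.log x ≤ x * Real.log (x + y) := by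
  rcases hx.eq_or_lt with h | h
  · simp [← h]
  · exact mul_le_mul_of_nonneg_left (Real.log_le_log h (by linarith)) hx

theorem mergeF_nonneg {x y : ℝ} (hx : 0 ≤ x) (hy : 0 ≤ y) : 0 ≤ mergeF x y := by
  unfold mergeF
  have h1 := mergeF_aux hx hy
  have h2 := mergeF_aux hy hx
  rw [add_comm y x] at h2
  nlinarith

theorem mergeF_smul {t x y : ℝ} (ht : 0 < t) (hx : 0 < x) (hy : 0 < y) :
    mergeF (t * x) (t * y) = t * mergeF x y := by
  unfold mergeF
  rw [← mul_add, Real.log_mul ht.ne' (by positivity), Real.log_mul ht.ne' hx.ne',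
    Real.log_mul ht.ne' hy.ne']
  ring

theorem mergeF_mono {x y u v : ℝ} (hx : 0 < x) (hy : 0 < y) (hu : x ≤ u) (hv : y ≤ v) :
    mergeF x y ≤ mergeF u v := by
  have hu0 : 0 < u := by linarith
  have hv0 : 0 < v := by linarith
  have gibbs : ∀ p q : ℝ, 0 < p → 0 < q →
      p * (Real.log q + Real.log (x + y) - Real.log p - Real.log (u + v))
        ≤ q * (x + y) / (u + v) - p := by
    intro p q hp hq
    have h := Real.log_le_sub_one_of_pos (show 0 < q * (x + y) / (p * (u + v)) by positivity)
    rw [Real.log_div (by positivity) (by positivity), Real.log_mul hq.ne' (by positivity),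
      Real.log_mul hp.ne' (by positivity)] at h
    have h2 := mul_le_mul_of_nonneg_left h hp.le
    have h3 : p * (q * (x + y) / (p * (u + v)) - 1) = q * (x + y) / (u + v) - p := by
      field_simp
    rw [h3] at h2
    linarith
  have g1 := gibbs x u hx hu0
  have g2 := gibbs y v hy hv0
  have g3 : u * (x + y) / (u + v) + v * (x + y) / (u + v) = x + y := by
    field_simp
  have l1 : Real.log u ≤ Real.log (u + v) := Real.log_le_log hu0 (by linarith)
  have l2 : Real.log v ≤ Real.log (u + v) := Real.log_le_log hv0 (by linarith)
  unfold mergeF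
  nlinarith [mul_nonneg (sub_nonneg.2 hu) (sub_nonneg.2 l1),
    mul_nonneg (sub_nonneg.2 hv) (sub_nonneg.2 l2)]

theorem clMI_term {N m w c : ℝ} (hN : 0 < N) (hm : 0 ≤ m) (hw : 0 < w) (hc : 0 < c) :
    (m / N) * Real.log (N * m / (w * c)) =
      (m * Real.log m + m * (Real.log N - Real.log c) - m * Real.log w) / N := by
  rcases hm.eq_or_lt with h | h
  · simp [← h]
  · rw [Real.log_div (by positivity) (by positivity), Real.log_mul hN.ne' h.ne',
      Real.log_mul hw.ne' hc.ne']
    ring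

theorem clEnt_term {N w : ℝ} (hN : 0 < N) (hw : 0 < w) :
    (w / N) * Real.log (w / N) = (w * Real.log w - w * Real.log N) / N := by
  rw [Real.log_div hw.ne' hN.ne']
  ring

theorem card_inter_sum {α : Type*} [DecidableEq α] {X : Finset α} {C : Finset (Finset α)}
    (hC : IsClustering X C) {w : Finset α} (hw : w ⊆ X) :
    ∑ c ∈ C, ((w ∩ c).card : ℝ) = w.card := by
  obtain ⟨_, h2, h3⟩ := hC
  rw [← Nat.cast_sum, ← Finset.card_biUnion]
  · congr 2
    ext a
    simp only [Finset.mem_biUnion, Finset.mem_inter]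
    constructor
    · rintro ⟨c, _, h, _⟩
      exact h
    · intro ha
      have := hw ha
      rw [← h3] at this
      simp only [Finset.mem_biUnion, id] at this
      obtain ⟨c, hc, hac⟩ := this
      exact ⟨c, hc, ha, hac⟩
  · intro c hc d hd hcd
    exact (h2 c hc d hd hcd).mono Finset.inter_subset_right Finset.inter_subset_right

theorem sum_split {α : Type*} [DecidableEq α] {X : Finset α} {Ω : Finset (Finset α)}
    (hΩ : IsClustering X Ω) {w₁ w₂ : Finset α} (hw₁ : w₁ ∈ Ω) (hw₂ : w₂ ∈ Ω) (hne : w₁ ≠ w₂)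
    (f : Finset α → ℝ) :
    ∑ w ∈ Ω, f w - ∑ w ∈ mergeClusters Ω w₁ w₂, f w = f w₁ + f w₂ - f (w₁ ∪ w₂) := by
  obtain ⟨h1, h2, _⟩ := hΩ
  have hnot : w₁ ∪ w₂ ∉ (Ω.erase w₁).erase w₂ := by
    intro h
    have hm := Finset.mem_of_mem_erase h
    have hd := h2 _ hw₁ _ (Finset.mem_of_mem_erase hm) (Finset.ne_of_mem_erase hm).symm
    obtain ⟨a, ha⟩ := h1 _ hw₁
    exact Finset.disjoint_left.1 hd ha (Finset.mem_union_left _ ha)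
  unfold mergeClusters
  rw [Finset.sum_insert hnot, ← Finset.add_sum_erase Ω f hw₁,
    ← Finset.add_sum_erase (Ω.erase w₁) f (Finset.mem_erase.2 ⟨hne.symm, hw₂⟩)]
  ring

/-- **Theorem (Guarantee for Cluster Aggregation).**
If two distinct clusters `w₁, w₂` of `Ω` have a common dominant class `c₁` with purities
`t₁, t₂ ≥ 0.7`, and the NMI `n₁` of `Ω` w.r.t. the ground truth `C` satisfies
`n₁ ≥ 2 (1.0586 - min t₁ t₂)`, then merging `w₁` and `w₂` does not decrease the NMI. -/
theorem cluster_aggregation_guarantee {α : Type*} [DecidableEq α]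
    (X : Finset α) (N : ℕ) (hN : X.card = N)
    (Ω C : Finset (Finset α)) (hΩ : IsClustering X Ω) (hC : IsClustering X C)
    (w₁ w₂ : Finset α) (hw₁ : w₁ ∈ Ω) (hw₂ : w₂ ∈ Ω) (hne : w₁ ≠ w₂)
    (c₁ : Finset α) (hc₁ : c₁ ∈ C)
    (hdom₁ : ∀ c ∈ C, (w₁ ∩ c).card ≤ (w₁ ∩ c₁).card)
    (hdom₂ : ∀ c ∈ C, (w₂ ∩ c).card ≤ (w₂ ∩ c₁).card)
    (t₁ t₂ : ℝ)
    (ht₁ : t₁ = ((w₁ ∩ c₁).card : ℝ) / (w₁.card : ℝ))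
    (ht₂ : t₂ = ((w₂ ∩ c₁).card : ℝ) / (w₂.card : ℝ))
    (ht₁7 : (0.7 : ℝ) ≤ t₁) (ht₂7 : (0.7 : ℝ) ≤ t₂)
    (hH : 0 < clEntropy N Ω + clEntropy N C)
    (hH' : 0 < clEntropy N (mergeClusters Ω w₁ w₂) + clEntropy N C)
    (hn₁ : clNMI N Ω C ≥ 2 * ((1.0586 : ℝ) - min t₁ t₂)) :
    clNMI N (mergeClusters Ω w₁ w₂) C ≥ clNMI N Ω C := by
  have hsub : ∀ w ∈ Ω, w ⊆ X := by
    intro w hw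
    rw [← hΩ.2.2]
    exact Finset.subset_biUnion_of_mem id hw
  have hdis := hΩ.2.1 _ hw₁ _ hw₂ hne
  have ha : (0 : ℝ) < w₁.card := by exact_mod_cast (hΩ.1 _ hw₁).card_pos
  have hb : (0 : ℝ) < w₂.card := by exact_mod_cast (hΩ.1 _ hw₂).card_pos
  have hNpos : (0 : ℝ) < N := by
    have : w₁.card ≤ N := hN ▸ Finset.card_le_card (hsub _ hw₁)
    have : (w₁.card : ℝ) ≤ N := by exact_mod_cast this
    linarith
  have hcu : ((w₁ ∪ w₂).card : ℝ) = w₁.card + w₂.card := by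
    exact_mod_cast Finset.card_union_of_disjoint hdis
  have hE : clEntropy N Ω - clEntropy N (mergeClusters Ω w₁ w₂)
      = mergeF w₁.card w₂.card / N := by
    have h := sum_split hΩ hw₁ hw₂ hne
      (fun w => ((w.card : ℝ) / N) * Real.log ((w.card : ℝ) / N))
    simp only [hcu] at h
    rw [clEnt_term hNpos ha, clEnt_term hNpos hb, clEnt_term hNpos (add_pos ha hb)] at h
    unfold clEntropy mergeF
    have e : ∀ p q : ℝ, -p - -q = -(p - q) := by intros; ring
    rw [e, h]
    ring
  have hI : clMI N Ω C - clMI N (mergeClusters Ω w₁ w₂) C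
      = (mergeF w₁.card w₂.card
        - ∑ c ∈ C, mergeF ((w₁ ∩ c).card : ℝ) ((w₂ ∩ c).card : ℝ)) / N := by
    unfold clMI
    rw [sum_split hΩ hw₁ hw₂ hne (fun w => ∑ c ∈ C, (((w ∩ c).card : ℝ) / N) *
      Real.log (((N : ℝ) * ((w ∩ c).card : ℝ)) / ((w.card : ℝ) * (c.card : ℝ))))]
    have s1 := card_inter_sum hC (hsub _ hw₁)
    have s2 := card_inter_sum hC (hsub _ hw₂)
    have key : mergeF w₁.card w₂.card =
        ∑ c ∈ C, (((w₁ ∩ c).card : ℝ) * (Real.log (w₁.card + w₂.card) - Real.log w₁.card)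
          + ((w₂ ∩ c).card : ℝ) * (Real.log (w₁.card + w₂.card) - Real.log w₂.card)) := by
      rw [Finset.sum_add_distrib, ← Finset.sum_mul, ← Finset.sum_mul, s1, s2]
      unfold mergeF
      ring
    rw [key]
    simp only [hcu]
    rw [← Finset.sum_add_distrib, ← Finset.sum_sub_distrib, ← Finset.sum_sub_distrib,
      Finset.sum_div]
    refine Finset.sum_congr rfl fun c hc => ?_
    have hcpos : (0 : ℝ) < c.card := by exact_mod_cast (hC.1 _ hc).card_pos
    have hci : (((w₁ ∪ w₂) ∩ c).card : ℝ) = (w₁ ∩ c).card + (w₂ ∩ c).card := by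
      rw [Finset.union_inter_distrib_right, Finset.card_union_of_disjoint
        (hdis.mono Finset.inter_subset_left Finset.inter_subset_left)]
      push_cast
      ring
    rw [hci, clMI_term hNpos (by positivity) ha hcpos, clMI_term hNpos (by positivity) hb hcpos,
      clMI_term hNpos (by positivity) (add_pos ha hb) hcpos]
    unfold mergeF
    ring
  have hmin : (0.7 : ℝ) ≤ min t₁ t₂ := le_min ht₁7 ht₂7
  set t := min t₁ t₂ with ht
  have htpos : 0 < t := by norm_num at hmin; linarith
  have hF : t * mergeF w₁.card w₂.card
      ≤ ∑ c ∈ C, mergeF ((w₁ ∩ c).card : ℝ) ((w₂ ∩ c).card : ℝ) := by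
    have h1 : t * w₁.card ≤ ((w₁ ∩ c₁).card : ℝ) := by
      rw [← le_div_iff₀ ha, ← ht₁]
      exact min_le_left _ _
    have h2 : t * w₂.card ≤ ((w₂ ∩ c₁).card : ℝ) := by
      rw [← le_div_iff₀ hb, ← ht₂]
      exact min_le_right _ _
    rw [← mergeF_smul htpos ha hb]
    refine (mergeF_mono (by positivity) (by positivity) h1 h2).trans ?_
    exact Finset.single_le_sum
      (f := fun c => mergeF ((w₁ ∩ c).card : ℝ) ((w₂ ∩ c).card : ℝ))
      (fun c _ => mergeF_nonneg (by positivity) (by positivity)) hc₁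
  have hF0 : 0 ≤ mergeF (w₁.card : ℝ) w₂.card / N :=
    div_nonneg (mergeF_nonneg ha.le hb.le) hNpos.le
  have hD : clMI N Ω C - clMI N (mergeClusters Ω w₁ w₂) C
      ≤ (1 - t) * (mergeF (w₁.card : ℝ) w₂.card / N) := by
    rw [hI, ← mul_div_assoc]
    exact div_le_div_of_nonneg_right (by linarith) hNpos.le
  unfold clNMI at hn₁ ⊢
  rw [ge_iff_le, le_div_iff₀ hH] at hn₁
  rw [ge_iff_le, div_le_div_iff₀ hH hH']
  generalize mergeF (w₁.card : ℝ) w₂.card / N = D at *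
  generalize clEntropy N (mergeClusters Ω w₁ w₂) = E' at *
  generalize clMI N (mergeClusters Ω w₁ w₂) C = I' at *
  generalize clMI N Ω C = I at *
  generalize hS : clEntropy N Ω + clEntropy N C = S at *
  have hE2 : E' + clEntropy N C = S - D := by linarith
  rw [hE2]
  have hn : (1 - t) * S ≤ I := by norm_num at hn₁; nlinarith
  have a1 := mul_le_mul_of_nonneg_right hn hF0
  have a2 := mul_le_mul_of_nonneg_left hD hH.le
  nlinarith
end

section
/- Let p, q be real numbers with 0 < p ≤ q, and let t_1, t_2 be real numbers with 0.7 ≤ t_1 ≤ 1 and 0.7 ≤ t_2 ≤ 1. Then t_1·p·log((t_1·p + t_2·q)/(t_1·(p+q))) + t_2·q·log((t_1·p + t_2·q)/(t_2·(p+q))) ≥ −0.0812·p. -/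
theorem log_aux7 : (-0.3812 : ℝ) ≤ Real.log 0.7 := by
  have e : (0.7 : ℝ) = (7/8) * ((8/9) * (9/10)) := by norm_num
  rw [e, Real.log_mul (by norm_num) (by norm_num), Real.log_mul (by norm_num) (by norm_num)]
  have h1 := Real.one_sub_inv_le_log_of_pos (show (0:ℝ) < 7/8 by norm_num)
  have h2 := Real.one_sub_inv_le_log_of_pos (show (0:ℝ) < 8/9 by norm_num)
  have h3 := Real.one_sub_inv_le_log_of_pos (show (0:ℝ) < 9/10 by norm_num)
  norm_num at h1 h2 h3 ⊢
  linarith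

theorem g_aux (a b : ℝ) (ha : 0.7 ≤ a) (ha' : a ≤ 1) (hb : 0.7 ≤ b) (hb' : b ≤ 1) :
    -0.0812 ≤ a * Real.log (b / a) + a - b := by
  have a0 : 0 < a := by linarith
  have b0 : 0 < b := by linarith
  rcases le_total a b with h | h
  · have hu : 0 ≤ b / a - 1 := by
      rw [sub_nonneg, le_div_iff₀ a0]; linarith
    have h1 := Real.le_log_one_add_of_nonneg hu
    rw [add_sub_cancel] at h1
    have h2 := mul_le_mul_of_nonneg_left h1 a0.le
    have e : a * (2 * (b / a - 1) / (b / a - 1 + 2)) + a - b = -((b - a)^2 / (a + b)) := by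
      have : b / a - 1 + 2 = (a + b) / a := by field_simp; ring
      rw [this]; field_simp; ring
    have h3 : (b - a)^2 / (a + b) ≤ 0.0812 := by
      rw [div_le_iff₀ (by linarith)]; nlinarith
    linarith
  · set u := b / a with hu
    have hbu : b = a * u := by rw [hu]; field_simp
    have u1 : u ≤ 1 := by rw [hu, div_le_one a0]; exact h
    have u7 : 0.7 ≤ u := by rw [hu, le_div_iff₀ a0]; nlinarith
    have hc := strictConcaveOn_log_Ioi.concaveOn.2 (show (0.7:ℝ) ∈ Set.Ioi 0 by norm_num)
      (show (1:ℝ) ∈ Set.Ioi 0 by norm_num) (show 0 ≤ (1-u)/0.3 by apply div_nonneg <;> linarith)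
      (show 0 ≤ (u-0.7)/0.3 by apply div_nonneg <;> linarith) (by ring)
    simp only [smul_eq_mul, Real.log_one, mul_zero, add_zero] at hc
    have e : (1 - u) / 0.3 * 0.7 + (u - 0.7) / 0.3 * 1 = u := by ring
    rw [e] at hc
    have h7 := mul_le_mul_of_nonneg_left log_aux7
      (show 0 ≤ (1-u)/0.3 by apply div_nonneg <;> linarith)
    have h8 : -0.0812 ≤ Real.log u + 1 - u := by
      have : (1 - u) / 0.3 * (-0.3812) + 1 - u = -(0.0812/0.3) * (1-u) := by ring
      norm_num at *
      linarith
    rw [hbu]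
    nlinarith

/-- Lower bound for Term (IV) of the paper:
`t₁ p log((t₁p+t₂q)/(t₁(p+q))) + t₂ q log((t₁p+t₂q)/(t₂(p+q))) ≥ -0.0812 p`. -/
theorem termIV_lowerBound (p q t₁ t₂ : ℝ) (hp : 0 < p) (hpq : p ≤ q)
    (ht₁ : (0.7 : ℝ) ≤ t₁) (ht₁' : t₁ ≤ 1) (ht₂ : (0.7 : ℝ) ≤ t₂) (ht₂' : t₂ ≤ 1) :
    t₁ * p * Real.log ((t₁ * p + t₂ * q) / (t₁ * (p + q))) +
      t₂ * q * Real.log ((t₁ * p + t₂ * q) / (t₂ * (p + q))) ≥ -(0.0812 : ℝ) * p := by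
  have a0 : 0 < t₁ := by linarith
  have b0 : 0 < t₂ := by linarith
  have q0 : 0 < q := by linarith
  have S0 : 0 < t₁ * p + t₂ * q := by positivity
  have hx : 0 < (t₁ * p + t₂ * q) / (t₂ * (p + q)) := by positivity
  have e : (t₁ * p + t₂ * q) / (t₁ * (p + q)) =
      (t₁ * p + t₂ * q) / (t₂ * (p + q)) * (t₂ / t₁) := by field_simp
  rw [e, Real.log_mul hx.ne' (by positivity)]
  have h1 := mul_le_mul_of_nonneg_left (Real.one_sub_inv_le_log_of_pos hx) S0.le
  have e2 : (t₁ * p + t₂ * q) * (1 - ((t₁ * p + t₂ * q) / (t₂ * (p + q)))⁻¹) = (t₁ - t₂) * p := by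
    field_simp; ring
  rw [e2] at h1
  have h2 := mul_le_mul_of_nonneg_right (g_aux t₁ t₂ ht₁ ht₁' ht₂ ht₂') hp.le
  linarith
end

section
/- Let p, q be real numbers with 0 < p ≤ q, and let t_1, t_2 be real numbers with 0.7 ≤ t_1 ≤ 1 and 0.7 ≤ t_2 ≤ 1. Then the series ∑_{v=1}^∞ (1/(2v)) · [ t_1·p·((t_1 − t_2)·q/(t_1·(p+q)))^{2v} + t_2·q·((t_1 − t_2)·p/(t_2·(p+q)))^{2v} ] converges and its sum is at most 0.0716·p. -/
/-- Bound on the square of the base of a single power. -/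
lemma base_sq_bound (d t c : ℝ) (hd : d ^ 2 ≤ 9 / 100) (ht : 7 / 10 ≤ t)
    (hc0 : 0 ≤ c) (hc1 : c ≤ 1) (v : ℕ) :
    t * ((d * c / t) ^ (2 * (v + 1))) ≤ 9 / 70 * c ^ 2 * (9 / 49 : ℝ) ^ v := by
  have htpos : 0 < t := by linarith
  have hX : (d * c / t) ^ 2 ≤ 9 / 49 := by
    rw [div_pow, div_le_iff₀ (by positivity)]
    have h1 : c ^ 2 ≤ 1 := by nlinarith
    have h2 : (d * c) ^ 2 ≤ 9 / 100 := by
      rw [mul_pow]; nlinarith [sq_nonneg d, sq_nonneg c]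
    nlinarith
  have hX0 : 0 ≤ (d * c / t) ^ 2 := sq_nonneg _
  have htX : t * (d * c / t) ^ 2 ≤ 9 / 70 * c ^ 2 := by
    have e : t * (d * c / t) ^ 2 = d ^ 2 * c ^ 2 / t := by field_simp
    rw [e, div_le_iff₀ htpos]
    have h1 : d ^ 2 * c ^ 2 ≤ 9 / 100 * c ^ 2 := by gcongr
    have h2 : c ^ 2 * (7 / 10) ≤ c ^ 2 * t := by gcongr
    nlinarith
  calc t * ((d * c / t) ^ (2 * (v + 1)))
      = t * (d * c / t) ^ 2 * ((d * c / t) ^ 2) ^ v := by rw [pow_mul, pow_succ]; ring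
    _ ≤ 9 / 70 * c ^ 2 * (9 / 49 : ℝ) ^ v := by gcongr


/-- The even part of the Taylor expansion of Term (IV) (Eq. (19) in the paper):
`∑_{v=1}^∞ (1/(2v)) [t₁ p ((t₁-t₂)q/(t₁(p+q)))^{2v} + t₂ q ((t₁-t₂)p/(t₂(p+q)))^{2v}]`
converges and its sum is at most `0.0716 p`.  (The index `v ≥ 1` is written as `v + 1`
for `v : ℕ`.) -/
theorem evenPart_upperBound (p q t₁ t₂ : ℝ) (hp : 0 < p) (hpq : p ≤ q)
    (ht₁ : (0.7 : ℝ) ≤ t₁) (ht₁' : t₁ ≤ 1) (ht₂ : (0.7 : ℝ) ≤ t₂) (ht₂' : t₂ ≤ 1) :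
    Summable (fun v : ℕ =>
      (1 / (2 * ((v : ℝ) + 1))) *
        (t₁ * p * ((t₁ - t₂) * q / (t₁ * (p + q))) ^ (2 * (v + 1)) +
         t₂ * q * ((t₁ - t₂) * p / (t₂ * (p + q))) ^ (2 * (v + 1)))) ∧
    (∑' v : ℕ,
      (1 / (2 * ((v : ℝ) + 1))) *
        (t₁ * p * ((t₁ - t₂) * q / (t₁ * (p + q))) ^ (2 * (v + 1)) +
         t₂ * q * ((t₁ - t₂) * p / (t₂ * (p + q))) ^ (2 * (v + 1))))
      ≤ (0.0716 : ℝ) * p := by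
  have hq : 0 < q := by linarith
  have hs : 0 < p + q := by linarith
  have ht1 : (7 / 10 : ℝ) ≤ t₁ := by norm_num at ht₁ ⊢; linarith
  have ht2 : (7 / 10 : ℝ) ≤ t₂ := by norm_num at ht₂ ⊢; linarith
  have hd : (t₁ - t₂) ^ 2 ≤ 9 / 100 := by nlinarith
  have hg : HasSum (fun v : ℕ => 9 / 70 * p *
      ((9 / 49 : ℝ) ^ v * (1 / 4) + if v = 0 then (1 / 4 : ℝ) else 0))
      (9 / 70 * p * ((1 - 9 / 49 : ℝ)⁻¹ * (1 / 4) + 1 / 4)) :=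
    (((hasSum_geometric_of_lt_one (by norm_num) (by norm_num)).mul_right _).add
      (hasSum_ite_eq 0 (1 / 4 : ℝ))).mul_left _
  have hnn : ∀ v : ℕ, 0 ≤ (1 / (2 * ((v : ℝ) + 1))) *
        (t₁ * p * ((t₁ - t₂) * q / (t₁ * (p + q))) ^ (2 * (v + 1)) +
         t₂ * q * ((t₁ - t₂) * p / (t₂ * (p + q))) ^ (2 * (v + 1))) := by
    intro v
    have h1 : 0 ≤ ((t₁ - t₂) * q / (t₁ * (p + q))) ^ (2 * (v + 1)) :=
      (even_two_mul _).pow_nonneg _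
    have h2 : 0 ≤ ((t₁ - t₂) * p / (t₂ * (p + q))) ^ (2 * (v + 1)) :=
      (even_two_mul _).pow_nonneg _
    have h3 : 0 < t₁ := by linarith
    have h4 : 0 < t₂ := by linarith
    positivity
  have hle : ∀ v : ℕ, (1 / (2 * ((v : ℝ) + 1))) *
        (t₁ * p * ((t₁ - t₂) * q / (t₁ * (p + q))) ^ (2 * (v + 1)) +
         t₂ * q * ((t₁ - t₂) * p / (t₂ * (p + q))) ^ (2 * (v + 1))) ≤
      9 / 70 * p * ((9 / 49 : ℝ) ^ v * (1 / 4) + if v = 0 then (1 / 4 : ℝ) else 0) := by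
    intro v
    have e1 : (t₁ - t₂) * q / (t₁ * (p + q)) = (t₁ - t₂) * (q / (p + q)) / t₁ := by
      rw [mul_div_assoc', div_div, mul_comm t₁]
    have e2 : (t₁ - t₂) * p / (t₂ * (p + q)) = (t₁ - t₂) * (p / (p + q)) / t₂ := by
      rw [mul_div_assoc', div_div, mul_comm t₂]
    have b1 := base_sq_bound (t₁ - t₂) t₁ (q / (p + q)) hd ht1 (by positivity)
      (by rw [div_le_one hs]; linarith) v
    have b2 := base_sq_bound (t₁ - t₂) t₂ (p / (p + q)) hd ht2 (by positivity)
      (by rw [div_le_one hs]; linarith) v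
    rw [e1, e2]
    have hr : (0 : ℝ) < (9 / 49 : ℝ) ^ v := by positivity
    have key : t₁ * p * ((t₁ - t₂) * (q / (p + q)) / t₁) ^ (2 * (v + 1)) +
         t₂ * q * ((t₁ - t₂) * (p / (p + q)) / t₂) ^ (2 * (v + 1))
        ≤ 9 / 70 * p * (9 / 49 : ℝ) ^ v := by
      have c1 := mul_le_mul_of_nonneg_left b1 hp.le
      have c2 := mul_le_mul_of_nonneg_left b2 hq.le
      have c3 : p * (q / (p + q)) ^ 2 + q * (p / (p + q)) ^ 2 ≤ p := by
        have : p * (q / (p + q)) ^ 2 + q * (p / (p + q)) ^ 2 = p * (q / (p + q)) := by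
          field_simp; ring
        rw [this]
        have : q / (p + q) ≤ 1 := by rw [div_le_one hs]; linarith
        nlinarith
      have c4 := mul_le_mul_of_nonneg_left c3 hr.le
      nlinarith
    have hw : 1 / (2 * ((v : ℝ) + 1)) * (9 / 49 : ℝ) ^ v ≤
        (9 / 49 : ℝ) ^ v * (1 / 4) + if v = 0 then (1 / 4 : ℝ) else 0 := by
      rcases Nat.eq_zero_or_pos v with rfl | hv
      · norm_num
      · have hv1 : (1 : ℝ) ≤ v := by exact_mod_cast hv
        have : 1 / (2 * ((v : ℝ) + 1)) ≤ 1 / 4 := by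
          apply one_div_le_one_div_of_le <;> linarith
        rw [if_neg hv.ne']
        nlinarith
    calc _ ≤ 1 / (2 * ((v : ℝ) + 1)) * (9 / 70 * p * (9 / 49 : ℝ) ^ v) := by
            gcongr
      _ = 9 / 70 * p * (1 / (2 * ((v : ℝ) + 1)) * (9 / 49 : ℝ) ^ v) := by ring
      _ ≤ _ := by gcongr
  have hsum := Summable.of_nonneg_of_le hnn hle hg.summable
  refine ⟨hsum, ?_⟩
  refine (hasSum_le hle hsum.hasSum hg).trans ?_
  norm_num
  nlinarith
end

section
/- Let p, q be real numbers with 0 < p ≤ q, and let t_1, t_2 be real numbers with 0.7 ≤ t_1 ≤ 1 and 0.7 ≤ t_2 ≤ 1. Then the series ∑_{v=1}^∞ (p·q·(t_1 − t_2)^{2v+1} / ((2v+1)·(p+q)^{2v+1})) · ( p^{2v}/t_2^{2v} − q^{2v}/t_1^{2v} ) converges and its sum is at least −0.0096·p. -/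
theorem oddPart_aux_term (p q t₁ t₂ : ℝ) (hp : 0 < p) (hpq : p ≤ q) (ht₁ : 0 < t₁) (ht₂ : 0 < t₂)
    (v : ℕ) :
    (p * q * (t₁ - t₂) ^ (2 * (v + 1) + 1) /
          ((2 * ((v : ℝ) + 1) + 1) * (p + q) ^ (2 * (v + 1) + 1))) *
        (p ^ (2 * (v + 1)) / t₂ ^ (2 * (v + 1)) - q ^ (2 * (v + 1)) / t₁ ^ (2 * (v + 1)))
    = p * ((q / (p + q)) * (t₁ - t₂) / (2 * (v : ℝ) + 3)) *
      ((((p / (p + q)) * (t₁ - t₂) / t₂) ^ 2) ^ (v + 1)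
        - (((q / (p + q)) * (t₁ - t₂) / t₁) ^ 2) ^ (v + 1)) := by
  have hs : p + q ≠ 0 := by linarith
  have h3 : 2 * (v : ℝ) + 3 ≠ 0 := by positivity
  have h3' : 2 * ((v : ℝ) + 1) + 1 = 2 * (v : ℝ) + 3 := by ring
  rw [h3', ← pow_mul, ← pow_mul]
  simp only [div_pow, mul_pow, pow_succ _ (2 * (v + 1))]
  field_simp

theorem oddPart_aux_abs (p b d x y : ℝ) (hp : 0 < p) (hb : 0 ≤ b) (hb1 : b ≤ 1)
    (hd : |d| ≤ 3 / 10) (hx : 0 ≤ x) (hy : 0 ≤ y) (hx1 : x ≤ 9 / 49) (hy1 : y ≤ 9 / 49) (v : ℕ) :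
    ‖p * (b * d / (2 * (v : ℝ) + 3)) * (x ^ (v + 1) - y ^ (v + 1))‖
      ≤ p * (9 / 49 : ℝ) ^ v := by
  rw [Real.norm_eq_abs, abs_mul, abs_mul, abs_of_pos hp, mul_assoc]
  apply mul_le_mul_of_nonneg_left _ hp.le
  have h3 : (1 : ℝ) ≤ 2 * (v : ℝ) + 3 := by
    have : (0 : ℝ) ≤ v := v.cast_nonneg
    linarith
  have h1 : |b * d / (2 * (v : ℝ) + 3)| ≤ 1 := by
    rw [abs_div, abs_mul, abs_of_nonneg hb, abs_of_pos (by linarith : (0 : ℝ) < 2 * (v : ℝ) + 3)]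
    rw [div_le_one (by linarith)]
    nlinarith [abs_nonneg d]
  have hX : x ^ (v + 1) ≤ (9 / 49 : ℝ) ^ (v + 1) := pow_le_pow_left₀ hx hx1 _
  have hY : y ^ (v + 1) ≤ (9 / 49 : ℝ) ^ (v + 1) := pow_le_pow_left₀ hy hy1 _
  have hX0 : 0 ≤ x ^ (v + 1) := by positivity
  have hY0 : 0 ≤ y ^ (v + 1) := by positivity
  have hr : (9 / 49 : ℝ) ^ (v + 1) ≤ (9 / 49 : ℝ) ^ v :=
    pow_le_pow_of_le_one (by norm_num) (by norm_num) (by omega)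
  have h2 : |x ^ (v + 1) - y ^ (v + 1)| ≤ (9 / 49 : ℝ) ^ v := by
    rw [abs_le]; constructor <;> linarith
  calc _ ≤ 1 * (9 / 49 : ℝ) ^ v := mul_le_mul h1 h2 (abs_nonneg _) zero_le_one
    _ = _ := one_mul _

theorem oddPart_aux_lower (p b d x y : ℝ) (hp : 0 < p) (hb : 0 ≤ b) (hb1 : b ≤ 1)
    (hd : |d| ≤ 3 / 10) (hx : 0 ≤ x) (hy : 0 ≤ y)
    (h : (0 ≤ d ∧ y ≤ 9 / 100) ∨ (d ≤ 0 ∧ x ≤ y)) (v : ℕ) :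
    -(p * ((3 / 10) / (2 * (v : ℝ) + 3) * (9 / 100 : ℝ) ^ (v + 1)))
      ≤ p * (b * d / (2 * (v : ℝ) + 3)) * (x ^ (v + 1) - y ^ (v + 1)) := by
  rw [mul_assoc, ← mul_neg]
  apply mul_le_mul_of_nonneg_left _ hp.le
  have h3 : (0 : ℝ) < 2 * (v : ℝ) + 3 := by positivity
  rcases h with ⟨h0, hy1⟩ | ⟨h0, hxy⟩
  · rw [abs_of_nonneg h0] at hd
    have hY : y ^ (v + 1) ≤ (9 / 100 : ℝ) ^ (v + 1) := pow_le_pow_left₀ hy hy1 _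
    have hX0 : 0 ≤ x ^ (v + 1) := by positivity
    have hY0 : 0 ≤ y ^ (v + 1) := by positivity
    have hk : b * d / (2 * (v : ℝ) + 3) ≤ (3 / 10) / (2 * (v : ℝ) + 3) := by
      gcongr
      nlinarith
    have hk0 : 0 ≤ b * d / (2 * (v : ℝ) + 3) := by positivity
    have := mul_le_mul hk hY hY0 (by positivity)
    nlinarith [mul_nonneg hk0 hX0]
  · have hXY : x ^ (v + 1) ≤ y ^ (v + 1) := pow_le_pow_left₀ hx hxy _
    have hk : b * d / (2 * (v : ℝ) + 3) ≤ 0 :=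
      div_nonpos_of_nonpos_of_nonneg (mul_nonpos_of_nonneg_of_nonpos hb h0) h3.le
    have h1 : 0 ≤ (3 / 10) / (2 * (v : ℝ) + 3) * (9 / 100 : ℝ) ^ (v + 1) := by positivity
    have h2 := mul_nonneg_of_nonpos_of_nonpos hk (sub_nonpos.2 hXY)
    linarith

/-- Lower bound on the odd part of the Taylor expansion (Eq. (22) in the paper):
`∑_{v=1}^∞ (pq(t₁-t₂)^{2v+1}/((2v+1)(p+q)^{2v+1})) (p^{2v}/t₂^{2v} - q^{2v}/t₁^{2v})`
converges and its sum is at least `-0.0096 p`.  (The index `v ≥ 1` is written as `v + 1`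
for `v : ℕ`.) -/
theorem oddPart_lowerBound (p q t₁ t₂ : ℝ) (hp : 0 < p) (hpq : p ≤ q)
    (ht₁ : (0.7 : ℝ) ≤ t₁) (ht₁' : t₁ ≤ 1) (ht₂ : (0.7 : ℝ) ≤ t₂) (ht₂' : t₂ ≤ 1) :
    Summable (fun v : ℕ =>
      (p * q * (t₁ - t₂) ^ (2 * (v + 1) + 1) /
          ((2 * ((v : ℝ) + 1) + 1) * (p + q) ^ (2 * (v + 1) + 1))) *
        (p ^ (2 * (v + 1)) / t₂ ^ (2 * (v + 1)) - q ^ (2 * (v + 1)) / t₁ ^ (2 * (v + 1)))) ∧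
    (∑' v : ℕ,
      (p * q * (t₁ - t₂) ^ (2 * (v + 1) + 1) /
          ((2 * ((v : ℝ) + 1) + 1) * (p + q) ^ (2 * (v + 1) + 1))) *
        (p ^ (2 * (v + 1)) / t₂ ^ (2 * (v + 1)) - q ^ (2 * (v + 1)) / t₁ ^ (2 * (v + 1))))
      ≥ -(0.0096 : ℝ) * p := by
  have hs : 0 < p + q := by linarith
  have h10 : 0 < t₁ := by linarith
  have h20 : 0 < t₂ := by linarith
  simp only [oddPart_aux_term p q t₁ t₂ hp hpq h10 h20]
  set a := p / (p + q) with ha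
  set b := q / (p + q) with hb
  set d := t₁ - t₂ with hdd
  have ha0 : 0 ≤ a := by positivity
  have hb0 : 0 ≤ b := by have : 0 < q := by linarith
                         positivity
  have hab : a ≤ b := by rw [ha, hb]; gcongr
  have hb1 : b ≤ 1 := by rw [hb, div_le_one hs]; linarith
  have hd : |d| ≤ 3 / 10 := by rw [abs_le]; constructor <;> linarith
  have key : ∀ c t : ℝ, 0 ≤ c → c ≤ 1 → 7 / 10 ≤ t → (c * d / t) ^ 2 ≤ 9 / 49 := by
    intro c t hc hc1 ht
    have ht0 : 0 < t := by linarith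
    have : |c * d / t| ≤ 3 / 7 := by
      rw [abs_div, abs_mul, abs_of_nonneg hc, abs_of_pos ht0, div_le_iff₀ ht0]
      nlinarith [abs_nonneg d]
    calc (c * d / t) ^ 2 = |c * d / t| ^ 2 := (sq_abs _).symm
      _ ≤ (3 / 7) ^ 2 := pow_le_pow_left₀ (abs_nonneg _) this 2
      _ = _ := by norm_num
  have hx1 := key a t₂ ha0 (hab.trans hb1) (by linarith)
  have hy1 := key b t₁ hb0 hb1 (by linarith)
  have hcase : (0 ≤ d ∧ (b * d / t₁) ^ 2 ≤ 9 / 100) ∨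
      (d ≤ 0 ∧ (a * d / t₂) ^ 2 ≤ (b * d / t₁) ^ 2) := by
    rcases le_total 0 d with h | h
    · left
      refine ⟨h, ?_⟩
      have h0 : 0 ≤ b * d / t₁ := by positivity
      have : b * d / t₁ ≤ 3 / 10 := by
        rw [div_le_iff₀ h10]
        nlinarith
      calc (b * d / t₁) ^ 2 ≤ (3 / 10) ^ 2 := pow_le_pow_left₀ h0 this 2
        _ = _ := by norm_num
    · right
      refine ⟨h, ?_⟩
      have h0 : 0 ≤ -d := by linarith
      have h1 : a * (-d) / t₂ ≤ b * (-d) / t₁ := by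
        have : t₁ ≤ t₂ := by linarith
        gcongr
      have := pow_le_pow_left₀ (by positivity) h1 2
      calc (a * d / t₂) ^ 2 = (a * (-d) / t₂) ^ 2 := by ring
        _ ≤ _ := this
        _ = _ := by ring
  have hx0 : 0 ≤ (a * d / t₂) ^ 2 := sq_nonneg _
  have hy0 : 0 ≤ (b * d / t₁) ^ 2 := sq_nonneg _
  have hA := oddPart_aux_abs p b d _ _ hp hb0 hb1 hd hx0 hy0 hx1 hy1
  have hL := oddPart_aux_lower p b d _ _ hp hb0 hb1 hd hx0 hy0 hcase
  have hsum := Summable.of_norm_bounded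
    ((summable_geometric_of_lt_one (by norm_num : (0 : ℝ) ≤ 9 / 49) (by norm_num)).mul_left p) hA
  refine ⟨hsum, ?_⟩
  rw [hsum.tsum_eq_zero_add]
  have hL0 := hL 0
  have hg := (hasSum_geometric_of_lt_one (by norm_num : (0 : ℝ) ≤ 9 / 100)
    (by norm_num)).mul_left (-(p * (3 / 50 * (9 / 100) ^ 2)))
  have hT := hasSum_le (fun v : ℕ => ?_) hg ((summable_nat_add_iff 1).2 hsum).hasSum
  · have h0 : -(p * (3 / 10 / (2 * ((0 : ℕ) : ℝ) + 3) * (9 / 100 : ℝ) ^ (0 + 1)))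
        = - (9 / 1000) * p := by
      norm_num
      ring
    rw [h0] at hL0
    have : -(p * (3 / 50 * (9 / 100) ^ 2)) * (1 - 9 / 100 : ℝ)⁻¹ ≥ -(6 / 10000) * p := by
      norm_num
      linarith
    linarith
  · refine le_trans ?_ (hL (v + 1))
    rw [neg_mul, neg_le_neg_iff, mul_assoc]
    apply mul_le_mul_of_nonneg_left _ hp.le
    have hv : (0 : ℝ) ≤ v := v.cast_nonneg
    have : (3 / 10 : ℝ) / (2 * ((v + 1 : ℕ) : ℝ) + 3) ≤ 3 / 50 := by
      rw [div_le_iff₀ (by positivity)]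
      push_cast
      linarith
    calc _ ≤ 3 / 50 * (9 / 100 : ℝ) ^ (v + 1 + 1) := by gcongr
      _ = _ := by ring
end

section
/- Let Ω be a clustering of a finite set X of N samples and let C be a clustering of X. Suppose two distinct clusters w_1, w_2 ∈ Ω with sizes p = |w_1| ≤ q = |w_2| have a common dominant class c_1 ∈ C, with purities t_1 = |w_1 ∩ c_1|/|w_1| ≥ 0.7 and t_2 = |w_2 ∩ c_1|/|w_2| ≥ 0.7. Let Ω* be obtained from Ω by merging w_1 and w_2, and set Δh = (1/N)·( p·log((p+q)/p) + q·log((p+q)/q) ). Then I(Ω*;C) ≥ I(Ω;C) − (1.0586 − min{t_1, t_2})·Δh. -/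
open Finset

lemma aux_split (N k p a : ℝ) (hN : 0 < N) (hk : 0 < k) (hp : 0 < p) (ha : 0 ≤ a) :
    a / N * Real.log (N * a / (p * k)) =
      (1 / N) * (a * (Real.log N - Real.log k) + a * (Real.log a - Real.log p)) := by
  rcases ha.eq_or_lt with h | h
  · simp [← h]
  · rw [Real.log_div (by positivity) (by positivity), Real.log_mul hN.ne' h.ne',
      Real.log_mul hp.ne' hk.ne']
    ring

lemma aux_off (p q a b : ℝ) (hp : 0 < p) (hq : 0 < q) (ha : 0 ≤ a) (hb : 0 ≤ b) :
    a * (Real.log a - Real.log p) + b * (Real.log b - Real.log q)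
      - (a + b) * (Real.log (a + b) - Real.log (p + q)) ≤
    a * Real.log ((p + q) / p) + b * Real.log ((p + q) / q) := by
  rw [Real.log_div (by positivity) hp.ne', Real.log_div (by positivity) hq.ne']
  have h1 : a * Real.log a ≤ a * Real.log (a + b) := by
    rcases ha.eq_or_lt with h | h
    · simp [← h]
    · exact mul_le_mul_of_nonneg_left (Real.log_le_log h (by linarith)) ha
  have h2 : b * Real.log b ≤ b * Real.log (a + b) := by
    rcases hb.eq_or_lt with h | h
    · simp [← h]
    · exact mul_le_mul_of_nonneg_left (Real.log_le_log h (by linarith)) hb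
  nlinarith

lemma aux_log_lower (p q : ℝ) (hp : 0 < p) (hq : 0 < q) :
    p / (p + q) ≤ Real.log ((p + q) / q) := by
  have := Real.one_sub_inv_le_log_of_pos (x := (p + q) / q) (by positivity)
  have h : 1 - ((p + q) / q)⁻¹ = p / (p + q) := by
    field_simp; ring
  linarith

lemma aux_dom (p q s t : ℝ) (hp : 0 < p) (hq : 0 < q) (hs : 0.7 ≤ s) (ht : 0.7 ≤ t)
    (ht1 : t ≤ 1) (hst : s ≤ t) :
    (p * s) * (Real.log (p * s) - Real.log p) + (q * t) * (Real.log (q * t) - Real.log q)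
      - (p * s + q * t) * (Real.log (p * s + q * t) - Real.log (p + q)) ≤
    (t - s) * (q * Real.log ((p + q) / q)) := by
  have hs0 : 0 < s := by linarith
  have ht0 : 0 < t := by linarith
  have hT : 0 < p * s + q * t := by positivity
  have e1 := Real.log_le_sub_one_of_pos (x := s * (p + q) / (p * s + q * t)) (by positivity)
  have e2 := Real.log_le_sub_one_of_pos (x := t * (p + q) / (p * s + q * t)) (by positivity)
  rw [Real.log_div (by positivity) hT.ne', Real.log_mul (by positivity) (by positivity)] at e1 e2
  rw [Real.log_mul hp.ne' hs0.ne', Real.log_mul hq.ne' ht0.ne']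
  have f1 := mul_le_mul_of_nonneg_left e1 (show 0 ≤ p * s by positivity)
  have f2 := mul_le_mul_of_nonneg_left e2 (show 0 ≤ q * t by positivity)
  have f3 := mul_le_mul_of_nonneg_left (aux_log_lower p q hp hq)
    (show 0 ≤ (t - s) * q from mul_nonneg (by linarith) hq.le)
  have key : p * s * (s * (p + q) / (p * s + q * t) - 1)
      + q * t * (t * (p + q) / (p * s + q * t) - 1) = p * q * (t - s) ^ 2 / (p * s + q * t) := by
    field_simp; ring
  have key2 : p * q * (t - s) ^ 2 / (p * s + q * t) ≤ (t - s) * q * (p / (p + q)) := by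
    rw [← mul_div_assoc, div_le_div_iff₀ hT (by positivity)]
    have : (t - s) * (p + q) ≤ p * s + q * t := by nlinarith
    have h := mul_le_mul_of_nonneg_left this
      (show 0 ≤ (t - s) * q * p from mul_nonneg (mul_nonneg (by linarith) hq.le) hp.le)
    linarith
  linarith

lemma aux_dom' (p q s t : ℝ) (hp : 0 < p) (hq : 0 < q) (hs : 0.7 ≤ s) (ht : 0.7 ≤ t)
    (hs1 : s ≤ 1) (ht1 : t ≤ 1) :
    (p * s) * (Real.log (p * s) - Real.log p) + (q * t) * (Real.log (q * t) - Real.log q)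
      - (p * s + q * t) * (Real.log (p * s + q * t) - Real.log (p + q)) ≤
    (s - min s t) * (p * Real.log ((p + q) / p)) +
    (t - min s t) * (q * Real.log ((p + q) / q)) := by
  rcases le_total s t with h | h
  · have := aux_dom p q s t hp hq hs ht ht1 h
    rw [min_eq_left h]; linarith
  · have := aux_dom q p t s hq hp ht hs hs1 h
    rw [min_eq_right h]
    rw [add_comm (q * t), add_comm q p] at this
    linarith

lemma aux_card_sum {α : Type*} [DecidableEq α] (X : Finset α) (C : Finset (Finset α))
    (hC : IsClustering X C) (w : Finset α) (hw : w ⊆ X) :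
    ∑ c ∈ C, ((w ∩ c).card : ℝ) = (w.card : ℝ) := by
  obtain ⟨-, hd, hu⟩ := hC
  rw [← Nat.cast_sum, ← Finset.card_biUnion]
  · congr 2
    ext x
    simp only [mem_biUnion, mem_inter]
    constructor
    · rintro ⟨c, -, h, -⟩; exact h
    · intro hx
      have := hw hx
      rw [← hu] at this
      simp only [mem_biUnion, id] at this
      obtain ⟨c, hc, hxc⟩ := this
      exact ⟨c, hc, hx, hxc⟩
  · intro c hc c' hc' hne
    exact (hd c hc c' hc' hne).mono inter_subset_right inter_subset_right

/-- Lower bound on the mutual information after merging two pure clusters (Eq. (27) in the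
paper): `I(Ω*;C) ≥ I(Ω;C) - (1.0586 - min t₁ t₂) Δh`. -/
theorem mutualInformation_merge_lowerBound {α : Type*} [DecidableEq α]
    (X : Finset α) (N : ℕ) (hN : X.card = N)
    (Ω C : Finset (Finset α)) (hΩ : IsClustering X Ω) (hC : IsClustering X C)
    (w₁ w₂ : Finset α) (hw₁ : w₁ ∈ Ω) (hw₂ : w₂ ∈ Ω) (hne : w₁ ≠ w₂)
    (c₁ : Finset α) (hc₁ : c₁ ∈ C)
    (hdom₁ : ∀ c ∈ C, (w₁ ∩ c).card ≤ (w₁ ∩ c₁).card)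
    (hdom₂ : ∀ c ∈ C, (w₂ ∩ c).card ≤ (w₂ ∩ c₁).card)
    (p q : ℝ) (hp : p = (w₁.card : ℝ)) (hq : q = (w₂.card : ℝ)) (hpq : p ≤ q)
    (t₁ t₂ : ℝ)
    (ht₁ : t₁ = ((w₁ ∩ c₁).card : ℝ) / (w₁.card : ℝ))
    (ht₂ : t₂ = ((w₂ ∩ c₁).card : ℝ) / (w₂.card : ℝ))
    (ht₁7 : (0.7 : ℝ) ≤ t₁) (ht₂7 : (0.7 : ℝ) ≤ t₂)
    (Δh : ℝ)
    (hΔh : Δh = (1 / (N : ℝ)) *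
      (p * Real.log ((p + q) / p) + q * Real.log ((p + q) / q))) :
    clMI N (mergeClusters Ω w₁ w₂) C ≥
      clMI N Ω C - ((1.0586 : ℝ) - min t₁ t₂) * Δh := by
  obtain ⟨hΩne, hΩd, hΩu⟩ := hΩ
  have hsub : ∀ w ∈ Ω, w ⊆ X := fun w hw => by
    rw [← hΩu]; exact subset_biUnion_of_mem id hw
  have hdisj := hΩd w₁ hw₁ w₂ hw₂ hne
  have hp0 : 0 < p := by rw [hp]; exact_mod_cast (hΩne w₁ hw₁).card_pos
  have hq0 : 0 < q := by rw [hq]; exact_mod_cast (hΩne w₂ hw₂).card_pos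
  have hN0 : (0 : ℝ) < N := by
    rw [← hN]
    exact_mod_cast ((hΩne w₁ hw₁).mono (hsub _ hw₁)).card_pos
  have hnot : w₁ ∪ w₂ ∉ (Ω.erase w₁).erase w₂ := by
    intro h
    simp only [mem_erase] at h
    have hd := hΩd _ h.2.2 w₁ hw₁ h.2.1
    obtain ⟨x, hx⟩ := hΩne w₁ hw₁
    exact Finset.disjoint_left.1 hd (mem_union_left _ hx) hx
  have hw₂' : w₂ ∈ Ω.erase w₁ := mem_erase.2 ⟨hne.symm, hw₂⟩
  have hs1 := aux_card_sum X C hC w₁ (hsub _ hw₁)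
  have hs2 := aux_card_sum X C hC w₂ (hsub _ hw₂)
  rw [← hp] at hs1 ht₁
  rw [← hq] at hs2 ht₂
  have ht1 : t₁ ≤ 1 := by
    rw [ht₁, div_le_one hp0, hp]
    exact_mod_cast card_le_card inter_subset_left
  have ht2 : t₂ ≤ 1 := by
    rw [ht₂, div_le_one hq0, hq]
    exact_mod_cast card_le_card inter_subset_left
  have ha1 : ((w₁ ∩ c₁).card : ℝ) = p * t₁ := by rw [ht₁, mul_div_cancel₀ _ hp0.ne']
  have hb1 : ((w₂ ∩ c₁).card : ℝ) = q * t₂ := by rw [ht₂, mul_div_cancel₀ _ hq0.ne']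
  have hcu : ((w₁ ∪ w₂).card : ℝ) = p + q := by
    rw [card_union_of_disjoint hdisj, hp, hq]; push_cast; rfl
  have hcuc : ∀ c, (((w₁ ∪ w₂) ∩ c).card : ℝ) = (w₁ ∩ c).card + (w₂ ∩ c).card := by
    intro c
    rw [union_inter_distrib_right, card_union_of_disjoint
      (hdisj.mono inter_subset_left inter_subset_left)]
    push_cast; rfl
  set L₁ := Real.log ((p + q) / p) with hL₁
  set L₂ := Real.log ((p + q) / q) with hL₂
  have hL1 : 0 ≤ L₁ := Real.log_nonneg (by rw [le_div_iff₀ hp0]; linarith)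
  have hL2 : 0 ≤ L₂ := Real.log_nonneg (by rw [le_div_iff₀ hq0]; linarith)
  -- the class-wise loss
  let G : Finset α → ℝ := fun c =>
    ((w₁ ∩ c).card : ℝ) * (Real.log (w₁ ∩ c).card - Real.log p)
      + ((w₂ ∩ c).card : ℝ) * (Real.log (w₂ ∩ c).card - Real.log q)
      - (((w₁ ∩ c).card : ℝ) + (w₂ ∩ c).card) *
        (Real.log (((w₁ ∩ c).card : ℝ) + (w₂ ∩ c).card) - Real.log (p + q))
  have hdiff : clMI N Ω C - clMI N (mergeClusters Ω w₁ w₂) C = (1 / (N : ℝ)) * ∑ c ∈ C, G c := by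
    unfold clMI mergeClusters
    rw [sum_insert hnot, ← add_sum_erase Ω _ hw₁, ← add_sum_erase (Ω.erase w₁) _ hw₂',
      ← add_assoc, add_sub_add_right_eq_sub, ← sum_add_distrib, ← sum_sub_distrib, mul_sum]
    refine sum_congr rfl fun c hc => ?_
    have hc0 : (0 : ℝ) < c.card := by exact_mod_cast (hC.1 c hc).card_pos
    rw [hcu, hcuc, ← hp, ← hq, aux_split N c.card p _ hN0 hc0 hp0 (Nat.cast_nonneg _),
      aux_split N c.card q _ hN0 hc0 hq0 (Nat.cast_nonneg _),
      aux_split N c.card (p + q) _ hN0 hc0 (add_pos hp0 hq0)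
        (add_nonneg (Nat.cast_nonneg _) (Nat.cast_nonneg _))]
    simp only [G]
    ring
  have hG : ∑ c ∈ C, G c ≤ (1 - min t₁ t₂) * (p * L₁ + q * L₂) := by
    rw [← add_sum_erase C _ hc₁]
    rw [← add_sum_erase C _ hc₁, ha1] at hs1
    rw [← add_sum_erase C _ hc₁, hb1] at hs2
    have h1 : G c₁ ≤ (t₁ - min t₁ t₂) * (p * L₁) + (t₂ - min t₁ t₂) * (q * L₂) := by
      have := aux_dom' p q t₁ t₂ hp0 hq0 ht₁7 ht₂7 ht1 ht2
      simp only [G, ha1, hb1]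
      exact this
    have h2 : ∑ c ∈ C.erase c₁, G c ≤
        (∑ c ∈ C.erase c₁, ((w₁ ∩ c).card : ℝ)) * L₁
          + (∑ c ∈ C.erase c₁, ((w₂ ∩ c).card : ℝ)) * L₂ := by
      rw [sum_mul, sum_mul, ← sum_add_distrib]
      exact sum_le_sum fun c _ => aux_off p q _ _ hp0 hq0 (Nat.cast_nonneg _) (Nat.cast_nonneg _)
    rw [eq_sub_of_add_eq' hs1, eq_sub_of_add_eq' hs2] at h2
    linarith
  have hD : 0 ≤ Δh := by rw [hΔh]; positivity
  have hfin : (1 / (N : ℝ)) * ∑ c ∈ C, G c ≤ (1 - min t₁ t₂) * Δh := by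
    have := mul_le_mul_of_nonneg_left hG (show 0 ≤ 1 / (N : ℝ) by positivity)
    rw [hΔh]; linarith
  have : clMI N Ω C - clMI N (mergeClusters Ω w₁ w₂) C ≤ (1 - min t₁ t₂) * Δh := hdiff ▸ hfin
  norm_num at *
  linarith
end

section
/- Let Ω be a clustering of a finite set X of N samples and let C be a clustering of X. Suppose two distinct clusters w_1, w_2 ∈ Ω satisfy w_1 ⊆ c_τ and w_2 ⊆ c_τ for some class c_τ ∈ C (i.e., both clusters have purity 1 with respect to the same class). Let Ω* be obtained from Ω by merging w_1 and w_2. Then I(Ω*;C) = I(Ω;C). -/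
open Finset

/-- Contribution of a pure nonempty cluster to the mutual information. -/
theorem pure_inner_sum {α : Type*} [DecidableEq α] (X : Finset α) (N : ℕ)
    (C : Finset (Finset α)) (hC : IsClustering X C) (w cτ : Finset α) (hcτ : cτ ∈ C)
    (hw : w.Nonempty) (hsub : w ⊆ cτ) :
    ∑ c ∈ C, (((w ∩ c).card : ℝ) / N) *
      Real.log (((N : ℝ) * ((w ∩ c).card : ℝ)) / ((w.card : ℝ) * (c.card : ℝ)))
    = (w.card : ℝ) / N * Real.log ((N : ℝ) / cτ.card) := by
  rw [Finset.sum_eq_single_of_mem cτ hcτ]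
  · rw [Finset.inter_eq_left.mpr hsub]
    have h : (w.card : ℝ) ≠ 0 := by
      exact_mod_cast hw.card_pos.ne'
    rw [mul_comm (N : ℝ), mul_div_mul_left _ _ h]
  · intro c hc hne
    have hd : Disjoint w c := (hC.2.1 cτ hcτ c hc hne.symm).mono_left hsub
    rw [Finset.disjoint_iff_inter_eq_empty.mp hd]
    simp

/-- If two distinct clusters `w₁, w₂` are both contained in the same class `cτ` (purity 1),
merging them leaves the mutual information unchanged: `I(Ω*;C) = I(Ω;C)`. -/
theorem mutualInformation_merge_of_pure {α : Type*} [DecidableEq α]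
    (X : Finset α) (N : ℕ) (hN : X.card = N)
    (Ω C : Finset (Finset α)) (hΩ : IsClustering X Ω) (hC : IsClustering X C)
    (w₁ w₂ : Finset α) (hw₁ : w₁ ∈ Ω) (hw₂ : w₂ ∈ Ω) (hne : w₁ ≠ w₂)
    (cτ : Finset α) (hcτ : cτ ∈ C) (hsub₁ : w₁ ⊆ cτ) (hsub₂ : w₂ ⊆ cτ) :
    clMI N (mergeClusters Ω w₁ w₂) C = clMI N Ω C := by
  have hn₁ := hΩ.1 w₁ hw₁
  have hn₂ := hΩ.1 w₂ hw₂
  have hd := hΩ.2.1 w₁ hw₁ w₂ hw₂ hne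
  have hnot : w₁ ∪ w₂ ∉ (Ω.erase w₁).erase w₂ := by
    intro h
    rw [Finset.mem_erase, Finset.mem_erase] at h
    have h1 := hΩ.2.1 w₁ hw₁ _ h.2.2 h.2.1.symm
    obtain ⟨x, hx⟩ := hn₁
    exact Finset.disjoint_left.mp h1 hx (Finset.mem_union_left _ hx)
  have hw₂' : w₂ ∈ Ω.erase w₁ := Finset.mem_erase.mpr ⟨hne.symm, hw₂⟩
  unfold clMI mergeClusters
  rw [Finset.sum_insert hnot, ← Finset.add_sum_erase Ω _ hw₁,
    ← Finset.add_sum_erase (Ω.erase w₁) _ hw₂',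
    pure_inner_sum X N C hC (w₁ ∪ w₂) cτ hcτ (hn₁.mono Finset.subset_union_left)
      (Finset.union_subset hsub₁ hsub₂),
    pure_inner_sum X N C hC w₁ cτ hcτ hn₁ hsub₁,
    pure_inner_sum X N C hC w₂ cτ hcτ hn₂ hsub₂,
    Finset.card_union_of_disjoint hd]
  push_cast
  ring
end

section
/- Let E be an equivalence relation on a set X, let C ⊆ X × X be symmetric and E-saturated, and let i, j ∈ X. Assume consistency: there is no pair (a,b) ∈ C with both a and b in [i]_E ∪ [j]_E. Let E' be the smallest equivalence relation containing E and the pair (i,j). Then the smallest symmetric, E'-saturated subset of X × X containing C is exactly C ∪ { (a,b) : a ∈ [i]_E ∪ [j]_E and ((i,b) ∈ C or (j,b) ∈ C) } ∪ { (b,a) : a ∈ [i]_E ∪ [j]_E and ((i,b) ∈ C or (j,b) ∈ C) }. -/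
/-- Merging two must-link classes: let `E'` be the smallest equivalence relation containing
`E` and `(i,j)`, and assume no cannot-link pair of `C` has both entries in `[i]_E ∪ [j]_E`.
Then the smallest symmetric `E'`-saturated subset of `X × X` containing `C` is exactly
`C ∪ {(a,b) : a ∈ [i]_E ∪ [j]_E, (i,b) ∈ C ∨ (j,b) ∈ C}` together with the swapped pairs. -/
theorem cannotLink_update_after_merge {X : Type*} (E : X → X → Prop) (hE : Equivalence E)
    (C : Set (X × X))
    (hCsym : ∀ a b, (a, b) ∈ C → (b, a) ∈ C)
    (hCsat : ∀ a a' b b', E a a' → E b b' → (a, b) ∈ C → (a', b') ∈ C)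
    (i j : X)
    (hcons : ¬ ∃ a b, (a, b) ∈ C ∧ (E i a ∨ E j a) ∧ (E i b ∨ E j b))
    (E' : X → X → Prop)
    (hE'equiv : Equivalence E') (hE'le : ∀ a b, E a b → E' a b) (hE'ij : E' i j)
    (hE'min : ∀ F : X → X → Prop, Equivalence F → (∀ a b, E a b → F a b) → F i j →
      ∀ a b, E' a b → F a b)
    (D : Set (X × X))
    (hD : D = C ∪ {p : X × X | (E i p.1 ∨ E j p.1) ∧ ((i, p.2) ∈ C ∨ (j, p.2) ∈ C)} ∪
      {p : X × X | (E i p.2 ∨ E j p.2) ∧ ((i, p.1) ∈ C ∨ (j, p.1) ∈ C)}) :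
    (C ⊆ D ∧ (∀ a b, (a, b) ∈ D → (b, a) ∈ D) ∧
        (∀ a a' b b', E' a a' → E' b b' → (a, b) ∈ D → (a', b') ∈ D)) ∧
      ∀ D' : Set (X × X), C ⊆ D' →
        (∀ a b, (a, b) ∈ D' → (b, a) ∈ D') →
        (∀ a a' b b', E' a a' → E' b b' → (a, b) ∈ D' → (a', b') ∈ D') →
        D ⊆ D' := by
  have hr := hE.refl
  have hM : ∀ x y, E x y → (E i x ∨ E j x) → (E i y ∨ E j y) := fun x y h h' =>
    h'.imp (fun k => hE.trans k h) (fun k => hE.trans k h)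
  have hE'c : ∀ a b, E' a b → E a b ∨ ((E i a ∨ E j a) ∧ (E i b ∨ E j b)) := by
    apply hE'min
    · refine ⟨fun x => Or.inl (hr x), ?_, ?_⟩
      · rintro x y (h | ⟨h, h'⟩)
        · exact Or.inl (hE.symm h)
        · exact Or.inr ⟨h', h⟩
      · rintro x y z (h | ⟨h, h'⟩) (k | ⟨k, k'⟩)
        · exact Or.inl (hE.trans h k)
        · exact Or.inr ⟨hM _ _ (hE.symm h) k, k'⟩
        · exact Or.inr ⟨h, hM _ _ k h'⟩
        · exact Or.inr ⟨h, k'⟩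
    · exact fun a b h => Or.inl h
    · exact Or.inr ⟨Or.inl (hr i), Or.inr (hr j)⟩
  have hmem : ∀ a b, (a, b) ∈ D ↔ ((a, b) ∈ C ∨
      ((E i a ∨ E j a) ∧ ((i, b) ∈ C ∨ (j, b) ∈ C))) ∨
      ((E i b ∨ E j b) ∧ ((i, a) ∈ C ∨ (j, a) ∈ C)) := by
    intro a b; rw [hD]; rfl
  have hsym : ∀ a b, (a, b) ∈ D → (b, a) ∈ D := by
    intro a b h
    rw [hmem] at h ⊢
    rcases h with (h | h) | h
    · exact Or.inl (Or.inl (hCsym _ _ h))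
    · exact Or.inr h
    · exact Or.inl (Or.inr h)
  have hone : ∀ a a' b, E' a a' → (a, b) ∈ D → (a', b) ∈ D := by
    intro a a' b h hd
    rw [hmem] at hd ⊢
    rcases hE'c _ _ h with h | ⟨h, h'⟩
    · rcases hd with (hd | ⟨m, n⟩) | ⟨m, n⟩
      · exact Or.inl (Or.inl (hCsat _ _ _ _ h (hr b) hd))
      · exact Or.inl (Or.inr ⟨hM _ _ h m, n⟩)
      · exact Or.inr ⟨m, n.imp (hCsat _ _ _ _ (hr i) h) (hCsat _ _ _ _ (hr j) h)⟩
    · rcases hd with (hd | ⟨m, n⟩) | ⟨m, n⟩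
      · exact Or.inl (Or.inr ⟨h', h.imp (fun k => hCsat _ _ _ _ (hE.symm k) (hr b) hd)
          (fun k => hCsat _ _ _ _ (hE.symm k) (hr b) hd)⟩)
      · exact Or.inl (Or.inr ⟨h', n⟩)
      · exfalso
        rcases n with n | n
        · exact hcons ⟨i, a, n, Or.inl (hr i), h⟩
        · exact hcons ⟨j, a, n, Or.inr (hr j), h⟩
  refine ⟨⟨?_, hsym, ?_⟩, ?_⟩
  · rintro ⟨a, b⟩ h
    exact (hmem a b).2 (Or.inl (Or.inl h))
  · intro a a' b b' ha hb h
    exact hsym _ _ (hone _ _ _ hb (hsym _ _ (hone _ _ _ ha h)))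
  · intro D' hC hs ht
    have key : ∀ a b, (E i a ∨ E j a) → ((i, b) ∈ C ∨ (j, b) ∈ C) → (a, b) ∈ D' := by
      intro a b m n
      have hia : E' i a := m.elim (hE'le _ _) (fun k => hE'equiv.trans hE'ij (hE'le _ _ k))
      rcases n with n | n
      · exact ht _ _ _ _ hia (hE'equiv.refl b) (hC n)
      · exact ht _ _ _ _ (hE'equiv.trans (hE'equiv.symm hE'ij) hia) (hE'equiv.refl b) (hC n)
    rintro ⟨a, b⟩ h
    rcases (hmem a b).1 h with (h | ⟨m, n⟩) | ⟨m, n⟩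
    · exact hC h
    · exact key _ _ m n
    · exact hs _ _ (key _ _ m n)
end
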